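/- arXiv:2501.11504 — 3 statements merged into one kernel-verified Lean document; each statement's English description precedes it below -/
import Mathlib

section
/- Let A_1, A_2 be associative, not necessarily unital ℂ-algebras. If (U_1, U_1^*) : (E_1, Θ_{A_1}(E_1)) → (F_1, Θ_{A_1}(F_1)) is a functional extension of right functional A_1-modules and (U_2, U_2^*) : (E_2, Θ_{A_2}(E_2)) → (F_2, Θ_{A_2}(F_2)) is a functional extension of right functional A_2-modules, then the assignment φ_1 ⊗ φ_2 ↦ U_1^*(φ_1) ⊗ U_2^*(φ_2) extends to a well-defined map U_1^* ⊗ U_2^* on the functional space of the external tensor product, and (U_1 ⊗ U_2, U_1^* ⊗ U_2^*) : E_1 ⊗ E_2 → F_1 ⊗ F_2 is a functional extension of right functional (A_1 ⊗_ℂ A_2)-modules. -/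
open scoped BigOperators TensorProduct

noncomputable section

/-- A right module structure for a (not necessarily unital) ℂ-algebra `A`
on a ℂ-vector space `E`. -/
structure RightMod (A : Type*) [NonUnitalRing A] [Module ℂ A]
    (E : Type*) [AddCommGroup E] [Module ℂ E] where
  sm : E → A → E
  add_sm : ∀ (x y : E) (a : A), sm (x + y) a = sm x a + sm y a
  sm_add : ∀ (x : E) (a b : A), sm x (a + b) = sm x a + sm x b
  sm_mul : ∀ (x : E) (a b : A), sm (sm x a) b = sm x (a * b)
  csm_left : ∀ (c : ℂ) (x : E) (a : A), sm (c • x) a = c • sm x a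
  csm_right : ∀ (c : ℂ) (x : E) (a : A), sm x (c • a) = c • sm x a

variable {A : Type*} [NonUnitalRing A] [Module ℂ A]

/-- `f : E → A` is a right `A`-module homomorphism into the standard module `A`. -/
def IsFunctional {E : Type*} [AddCommGroup E] [Module ℂ E]
    (r : RightMod A E) (f : E → A) : Prop :=
  (∀ x y : E, f (x + y) = f x + f y) ∧ (∀ (c : ℂ) (x : E), f (c • x) = c • f x) ∧
    ∀ (x : E) (a : A), f (r.sm x a) = f x * a

/-- `Θ` is a functional space for the right `A`-module `(E, r)`:
a `G`-invariant left `A`-submodule of `Hom_A(E,A)`. -/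
structure IsFunctionalSpace {E : Type*} [AddCommGroup E] [Module ℂ E]
    (r : RightMod A E) (Θ : Set (E → A)) : Prop where
  functional : ∀ φ ∈ Θ, IsFunctional r φ
  zero_mem : (0 : E → A) ∈ Θ
  add_mem : ∀ {φ ψ : E → A}, φ ∈ Θ → ψ ∈ Θ → φ + ψ ∈ Θ
  neg_mem : ∀ {φ : E → A}, φ ∈ Θ → -φ ∈ Θ
  csmul_mem : ∀ (c : ℂ) {φ : E → A}, φ ∈ Θ → c • φ ∈ Θ
  lsmul_mem : ∀ (a : A) {φ : E → A}, φ ∈ Θ → (fun x => a * φ x) ∈ Θ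

/-- Right `A`-module homomorphism between two right `A`-modules. -/
def IsModHom {E F : Type*} [AddCommGroup E] [Module ℂ E] [AddCommGroup F] [Module ℂ F]
    (rE : RightMod A E) (rF : RightMod A F) (U : E → F) : Prop :=
  (∀ x y : E, U (x + y) = U x + U y) ∧ (∀ (c : ℂ) (x : E), U (c • x) = c • U x) ∧
    ∀ (x : E) (a : A), U (rE.sm x a) = rF.sm (U x) a

/-- A homomorphism of functional modules `(U, U^*)`. -/
structure IsFunctionalHom {E F : Type*} [AddCommGroup E] [Module ℂ E]
    [AddCommGroup F] [Module ℂ F]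
    (rE : RightMod A E) (ΘE : Set (E → A)) (rF : RightMod A F) (ΘF : Set (F → A))
    (U : E → F) (Ustar : (E → A) → F → A) : Prop where
  hom : IsModHom rE rF U
  maps_mem : ∀ {φ : E → A}, φ ∈ ΘE → Ustar φ ∈ ΘF
  star_add : ∀ {φ ψ : E → A}, φ ∈ ΘE → ψ ∈ ΘE → Ustar (φ + ψ) = Ustar φ + Ustar ψ
  star_csmul : ∀ (c : ℂ) {φ : E → A}, φ ∈ ΘE → Ustar (c • φ) = c • Ustar φ
  star_lsmul : ∀ (a : A) {φ : E → A}, φ ∈ ΘE →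
      Ustar (fun x => a * φ x) = fun y => a * Ustar φ y
  compat : ∀ {φ : E → A}, φ ∈ ΘE → ∀ x : E, Ustar φ (U x) = φ x

/-- A functional extension. -/
structure IsFunctionalExtension {E F : Type*} [AddCommGroup E] [Module ℂ E]
    [AddCommGroup F] [Module ℂ F]
    (rE : RightMod A E) (ΘE : Set (E → A)) (rF : RightMod A F) (ΘF : Set (F → A))
    (U : E → F) (Ustar : (E → A) → F → A)
    extends IsFunctionalHom rE ΘE rF ΘF U Ustar : Prop where
  inj : Function.Injective U
  lift : ∀ (k : ℕ) (φ : Fin k → E → A), (∀ i, φ i ∈ ΘE) → ∀ η : F,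
      ∃ ξ : E, ∀ i, Ustar (φ i) η = φ i ξ

/-- The elementary compact operator `θ_{η,φ}`. -/
def elemOp {E : Type*} [AddCommGroup E] [Module ℂ E]
    (r : RightMod A E) (η : E) (φ : E → A) : E → E :=
  fun ξ => r.sm η (φ ξ)

/-- The set of compact operators on `(E, r, Θ)`: finite sums of elementary operators. -/
def KSet {E : Type*} [AddCommGroup E] [Module ℂ E]
    (r : RightMod A E) (Θ : Set (E → A)) : Set (E → E) :=
  { T | ∃ (m : ℕ) (η : Fin m → E) (φ : Fin m → E → A),
      (∀ i, φ i ∈ Θ) ∧ T = ∑ i, elemOp r (η i) (φ i) }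

end

section ExtTensor

variable {A₁ A₂ E₁ E₂ : Type*} [NonUnitalRing A₁] [Module ℂ A₁]
  [SMulCommClass ℂ A₁ A₁] [IsScalarTower ℂ A₁ A₁]
  [NonUnitalRing A₂] [Module ℂ A₂] [SMulCommClass ℂ A₂ A₂] [IsScalarTower ℂ A₂ A₂]
  [AddCommGroup E₁] [Module ℂ E₁] [AddCommGroup E₂] [Module ℂ E₂]

/-- The functional space of the external tensor product `E₁ ⊗ E₂`: the linear
span of the functionals `φ₁ ⊗ φ₂` determined by
`(φ₁ ⊗ φ₂)(ξ₁ ⊗ ξ₂) = φ₁(ξ₁) ⊗ φ₂(ξ₂)`. -/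
def extTensTheta (Θ₁ : Set (E₁ → A₁)) (Θ₂ : Set (E₂ → A₂)) :
    Set (TensorProduct ℂ E₁ E₂ → TensorProduct ℂ A₁ A₂) :=
  ↑(Submodule.span ℂ { h : TensorProduct ℂ E₁ E₂ → TensorProduct ℂ A₁ A₂ |
      ∃ φ₁ ∈ Θ₁, ∃ φ₂ ∈ Θ₂, (∀ x y, h (x + y) = h x + h y) ∧
        ∀ (ξ₁ : E₁) (ξ₂ : E₂), h (ξ₁ ⊗ₜ[ℂ] ξ₂) = φ₁ ξ₁ ⊗ₜ[ℂ] φ₂ ξ₂ })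

end ExtTensor

section TensorFunctional

variable {A₁ A₂ E₁ E₂ F₁ F₂ : Type*} [NonUnitalRing A₁] [Module ℂ A₁]
  [NonUnitalRing A₂] [Module ℂ A₂]
  [AddCommGroup E₁] [Module ℂ E₁] [AddCommGroup E₂] [Module ℂ E₂]
  [AddCommGroup F₁] [Module ℂ F₁] [AddCommGroup F₂] [Module ℂ F₂]

/-- `h` is the functional `φ₁ ⊗ φ₂` on the external tensor product. -/
def IsTensorFunctional (φ₁ : E₁ → A₁) (φ₂ : E₂ → A₂) (h : E₁ ⊗[ℂ] E₂ → A₁ ⊗[ℂ] A₂) : Prop :=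
  (∀ x y, h (x + y) = h x + h y) ∧
    ∀ (ξ₁ : E₁) (ξ₂ : E₂), h (ξ₁ ⊗ₜ[ℂ] ξ₂) = φ₁ ξ₁ ⊗ₜ[ℂ] φ₂ ξ₂

/-- The underlying linear map of a functional. -/
def IsFunctional.toLinearMap {r₁ : RightMod A₁ E₁} {φ : E₁ → A₁} (h : IsFunctional r₁ φ) :
    E₁ →ₗ[ℂ] A₁ where
  toFun := φ
  map_add' := h.1
  map_smul' := h.2.1

/-- The underlying linear map of a module homomorphism. -/
def IsModHom.toLinearMap {rE : RightMod A₁ E₁} {rF : RightMod A₁ F₁} {U : E₁ → F₁}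
    (h : IsModHom rE rF U) : E₁ →ₗ[ℂ] F₁ where
  toFun := U
  map_add' := h.1
  map_smul' := h.2.1

theorem RightMod.zero_sm (r : RightMod A₁ E₁) (a : A₁) : r.sm 0 a = 0 := by
  simpa using r.csm_left 0 0 a

theorem RightMod.sm_zero (r : RightMod A₁ E₁) (x : E₁) : r.sm x 0 = 0 := by
  simpa using r.csm_right 0 x 0

namespace IsTensorFunctional

theorem exists_of_isFunctional {r₁ : RightMod A₁ E₁} {r₂ : RightMod A₂ E₂}
    {φ₁ : E₁ → A₁} {φ₂ : E₂ → A₂} (h₁ : IsFunctional r₁ φ₁) (h₂ : IsFunctional r₂ φ₂) :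
    ∃ h, IsTensorFunctional φ₁ φ₂ h :=
  ⟨TensorProduct.map h₁.toLinearMap h₂.toLinearMap, map_add _, fun _ _ => rfl⟩

theorem map_zero {φ₁ : E₁ → A₁} {φ₂ : E₂ → A₂} {h : E₁ ⊗[ℂ] E₂ → A₁ ⊗[ℂ] A₂}
    (hh : IsTensorFunctional φ₁ φ₂ h) : h 0 = 0 := by
  simpa using hh.1 0 0

theorem mul_left [SMulCommClass ℂ A₁ A₁] [IsScalarTower ℂ A₁ A₁]
    [SMulCommClass ℂ A₂ A₂] [IsScalarTower ℂ A₂ A₂]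
    {φ₁ : E₁ → A₁} {φ₂ : E₂ → A₂} {h : E₁ ⊗[ℂ] E₂ → A₁ ⊗[ℂ] A₂}
    (hh : IsTensorFunctional φ₁ φ₂ h) (a₁ : A₁) (a₂ : A₂) :
    IsTensorFunctional (fun x => a₁ * φ₁ x) (fun x => a₂ * φ₂ x)
      (fun x => (a₁ ⊗ₜ[ℂ] a₂) * h x) :=
  ⟨fun x y => by simp only [hh.1, mul_add],
    fun ξ₁ ξ₂ => by simp only [hh.2, Algebra.TensorProduct.tmul_mul_tmul]⟩

end IsTensorFunctional

/-- The pairs `(φ₁ ⊗ φ₂, U₁^*(φ₁) ⊗ U₂^*(φ₂))`. -/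
def tensorStarPairs (Θ₁ : Set (E₁ → A₁)) (Θ₂ : Set (E₂ → A₂))
    (U₁s : (E₁ → A₁) → F₁ → A₁) (U₂s : (E₂ → A₂) → F₂ → A₂) :
    Set ((E₁ ⊗[ℂ] E₂ → A₁ ⊗[ℂ] A₂) × (F₁ ⊗[ℂ] F₂ → A₁ ⊗[ℂ] A₂)) :=
  {p | ∃ φ₁ ∈ Θ₁, ∃ φ₂ ∈ Θ₂,
    IsTensorFunctional φ₁ φ₂ p.1 ∧ IsTensorFunctional (U₁s φ₁) (U₂s φ₂) p.2}

/-- The graph of `U₁^* ⊗ U₂^*`. -/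
def tensorStarGraph (Θ₁ : Set (E₁ → A₁)) (Θ₂ : Set (E₂ → A₂))
    (U₁s : (E₁ → A₁) → F₁ → A₁) (U₂s : (E₂ → A₂) → F₂ → A₂) :
    Submodule ℂ ((E₁ ⊗[ℂ] E₂ → A₁ ⊗[ℂ] A₂) × (F₁ ⊗[ℂ] F₂ → A₁ ⊗[ℂ] A₂)) :=
  Submodule.span ℂ (tensorStarPairs Θ₁ Θ₂ U₁s U₂s)

section Graph

variable {rE₁ : RightMod A₁ E₁} {ΘE₁ : Set (E₁ → A₁)} {rE₂ : RightMod A₂ E₂}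
  {ΘE₂ : Set (E₂ → A₂)} {rF₁ : RightMod A₁ F₁} {ΘF₁ : Set (F₁ → A₁)}
  {rF₂ : RightMod A₂ F₂} {ΘF₂ : Set (F₂ → A₂)}
  {U₁ : E₁ → F₁} {U₁s : (E₁ → A₁) → F₁ → A₁} {U₂ : E₂ → F₂} {U₂s : (E₂ → A₂) → F₂ → A₂}

theorem IsFunctionalExtension.exists_lift_of_finite {ι : Type*} [Finite ι]
    (hU : IsFunctionalExtension rE₁ ΘE₁ rF₁ ΘF₁ U₁ U₁s) {φ : ι → E₁ → A₁}
    (hφ : ∀ i, φ i ∈ ΘE₁) (η : F₁) : ∃ ξ : E₁, ∀ i, U₁s (φ i) η = φ i ξ := by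
  obtain ⟨n, ⟨e⟩⟩ := Finite.exists_equiv_fin ι
  obtain ⟨ξ, hξ⟩ := hU.lift n (fun i => φ (e.symm i)) (fun i => hφ _) η
  exact ⟨ξ, fun i => by simpa using hξ (e i)⟩

theorem exists_lift_of_subset_tensorStarPairs
    (hU₁ : IsFunctionalExtension rE₁ ΘE₁ rF₁ ΘF₁ U₁ U₁s)
    (hU₂ : IsFunctionalExtension rE₂ ΘE₂ rF₂ ΘF₂ U₂ U₂s)
    {T : Set ((E₁ ⊗[ℂ] E₂ → A₁ ⊗[ℂ] A₂) × (F₁ ⊗[ℂ] F₂ → A₁ ⊗[ℂ] A₂))} (hfin : T.Finite)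
    (hT : T ⊆ tensorStarPairs ΘE₁ ΘE₂ U₁s U₂s) (η : F₁ ⊗[ℂ] F₂) :
    ∃ ξ : E₁ ⊗[ℂ] E₂, ∀ p ∈ T, p.2 η = p.1 ξ := by
  have := hfin.to_subtype
  induction η with
  | zero =>
    refine ⟨0, fun p hp => ?_⟩
    obtain ⟨_, _, _, _, h, k⟩ := hT hp
    rw [h.map_zero, k.map_zero]
  | add x y hx hy =>
    obtain ⟨ξ, hξ⟩ := hx
    obtain ⟨ξ', hξ'⟩ := hy
    refine ⟨ξ + ξ', fun p hp => ?_⟩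
    obtain ⟨_, _, _, _, h, k⟩ := hT hp
    rw [h.1, k.1, hξ p hp, hξ' p hp]
  | tmul η₁ η₂ =>
    choose φ₁ hφ₁ φ₂ hφ₂ h k using fun p : T => hT p.2
    obtain ⟨ξ₁, hξ₁⟩ := hU₁.exists_lift_of_finite hφ₁ η₁
    obtain ⟨ξ₂, hξ₂⟩ := hU₂.exists_lift_of_finite hφ₂ η₂
    refine ⟨ξ₁ ⊗ₜ ξ₂, fun p hp => ?_⟩
    rw [(h ⟨p, hp⟩).2, (k ⟨p, hp⟩).2, hξ₁, hξ₂]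

theorem exists_lift_of_mem_tensorStarGraph {ι : Type*} [Finite ι]
    (hU₁ : IsFunctionalExtension rE₁ ΘE₁ rF₁ ΘF₁ U₁ U₁s)
    (hU₂ : IsFunctionalExtension rE₂ ΘE₂ rF₂ ΘF₂ U₂ U₂s)
    {p : ι → (E₁ ⊗[ℂ] E₂ → A₁ ⊗[ℂ] A₂) × (F₁ ⊗[ℂ] F₂ → A₁ ⊗[ℂ] A₂)}
    (hp : ∀ i, p i ∈ tensorStarGraph ΘE₁ ΘE₂ U₁s U₂s) (η : F₁ ⊗[ℂ] F₂) :
    ∃ ξ : E₁ ⊗[ℂ] E₂, ∀ i, (p i).2 η = (p i).1 ξ := by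
  choose T hT hpT using fun i => Submodule.mem_span_finite_of_mem_span (hp i)
  obtain ⟨ξ, hξ⟩ := exists_lift_of_subset_tensorStarPairs hU₁ hU₂
    (Set.finite_iUnion fun i => (T i).finite_toSet) (Set.iUnion_subset hT) η
  refine ⟨ξ, fun i => ?_⟩
  have hi := hpT i
  generalize p i = q at hi
  induction hi using Submodule.span_induction with
  | mem q hq => exact hξ q (Set.mem_iUnion_of_mem i hq)
  | zero => rfl
  | add q q' _ _ h h' => simp [h, h']
  | smul c q _ h => simp [h]

theorem tensorStarGraph_right_unique
    (hU₁ : IsFunctionalExtension rE₁ ΘE₁ rF₁ ΘF₁ U₁ U₁s)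
    (hU₂ : IsFunctionalExtension rE₂ ΘE₂ rF₂ ΘF₂ U₂ U₂s)
    {h : E₁ ⊗[ℂ] E₂ → A₁ ⊗[ℂ] A₂} {k k' : F₁ ⊗[ℂ] F₂ → A₁ ⊗[ℂ] A₂}
    (hk : (h, k) ∈ tensorStarGraph ΘE₁ ΘE₂ U₁s U₂s)
    (hk' : (h, k') ∈ tensorStarGraph ΘE₁ ΘE₂ U₁s U₂s) : k = k' := by
  funext η
  obtain ⟨ξ, hξ⟩ := exists_lift_of_mem_tensorStarGraph hU₁ hU₂ (p := fun b : Bool =>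
    (h, if b then k else k')) (by rintro (_ | _) <;> simpa) η
  exact (hξ true).trans (hξ false).symm

theorem exists_mem_tensorStarPairs (hF₁ : IsFunctionalSpace rF₁ ΘF₁)
    (hF₂ : IsFunctionalSpace rF₂ ΘF₂) (hU₁ : IsFunctionalExtension rE₁ ΘE₁ rF₁ ΘF₁ U₁ U₁s)
    (hU₂ : IsFunctionalExtension rE₂ ΘE₂ rF₂ ΘF₂ U₂ U₂s) {φ₁ : E₁ → A₁} (hφ₁ : φ₁ ∈ ΘE₁)
    {φ₂ : E₂ → A₂} (hφ₂ : φ₂ ∈ ΘE₂) {h : E₁ ⊗[ℂ] E₂ → A₁ ⊗[ℂ] A₂}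
    (hh : IsTensorFunctional φ₁ φ₂ h) :
    ∃ k, (h, k) ∈ tensorStarPairs ΘE₁ ΘE₂ U₁s U₂s ∧
      IsTensorFunctional (U₁s φ₁) (U₂s φ₂) k := by
  obtain ⟨k, hk⟩ := IsTensorFunctional.exists_of_isFunctional
    (hF₁.functional _ (hU₁.maps_mem hφ₁)) (hF₂.functional _ (hU₂.maps_mem hφ₂))
  exact ⟨k, ⟨φ₁, hφ₁, φ₂, hφ₂, hh, hk⟩, hk⟩

theorem exists_mem_tensorStarGraph (hF₁ : IsFunctionalSpace rF₁ ΘF₁)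
    (hF₂ : IsFunctionalSpace rF₂ ΘF₂) (hU₁ : IsFunctionalExtension rE₁ ΘE₁ rF₁ ΘF₁ U₁ U₁s)
    (hU₂ : IsFunctionalExtension rE₂ ΘE₂ rF₂ ΘF₂ U₂ U₂s)
    {h : E₁ ⊗[ℂ] E₂ → A₁ ⊗[ℂ] A₂} (hh : h ∈ extTensTheta ΘE₁ ΘE₂) :
    ∃ k, (h, k) ∈ tensorStarGraph ΘE₁ ΘE₂ U₁s U₂s := by
  induction hh using Submodule.span_induction with
  | mem h hh =>
    obtain ⟨φ₁, hφ₁, φ₂, hφ₂, hh⟩ := hh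
    obtain ⟨k, hk, -⟩ := exists_mem_tensorStarPairs hF₁ hF₂ hU₁ hU₂ hφ₁ hφ₂ hh
    exact ⟨k, Submodule.subset_span hk⟩
  | zero => exact ⟨0, zero_mem _⟩
  | add _ _ _ _ h h' =>
    obtain ⟨k, hk⟩ := h
    obtain ⟨k', hk'⟩ := h'
    exact ⟨k + k', add_mem hk hk'⟩
  | smul c _ _ h =>
    obtain ⟨k, hk⟩ := h
    exact ⟨c • k, Submodule.smul_mem _ c hk⟩

theorem fst_mem_extTensTheta
    {p : (E₁ ⊗[ℂ] E₂ → A₁ ⊗[ℂ] A₂) × (F₁ ⊗[ℂ] F₂ → A₁ ⊗[ℂ] A₂)}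
    (hp : p ∈ tensorStarGraph ΘE₁ ΘE₂ U₁s U₂s) : p.1 ∈ extTensTheta ΘE₁ ΘE₂ := by
  induction hp using Submodule.span_induction with
  | mem p hp =>
    obtain ⟨φ₁, hφ₁, φ₂, hφ₂, hh, -⟩ := hp
    exact Submodule.subset_span ⟨φ₁, hφ₁, φ₂, hφ₂, hh⟩
  | zero => exact Submodule.zero_mem _
  | add _ _ _ _ h h' => exact Submodule.add_mem _ h h'
  | smul c _ _ h => exact Submodule.smul_mem _ c h

theorem snd_mem_extTensTheta (hU₁ : IsFunctionalExtension rE₁ ΘE₁ rF₁ ΘF₁ U₁ U₁s)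
    (hU₂ : IsFunctionalExtension rE₂ ΘE₂ rF₂ ΘF₂ U₂ U₂s)
    {p : (E₁ ⊗[ℂ] E₂ → A₁ ⊗[ℂ] A₂) × (F₁ ⊗[ℂ] F₂ → A₁ ⊗[ℂ] A₂)}
    (hp : p ∈ tensorStarGraph ΘE₁ ΘE₂ U₁s U₂s) : p.2 ∈ extTensTheta ΘF₁ ΘF₂ := by
  induction hp using Submodule.span_induction with
  | mem p hp =>
    obtain ⟨φ₁, hφ₁, φ₂, hφ₂, -, hk⟩ := hp
    exact Submodule.subset_span ⟨_, hU₁.maps_mem hφ₁, _, hU₂.maps_mem hφ₂, hk⟩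
  | zero => exact Submodule.zero_mem _
  | add _ _ _ _ h h' => exact Submodule.add_mem _ h h'
  | smul c _ _ h => exact Submodule.smul_mem _ c h

theorem mul_mem_tensorStarGraph [SMulCommClass ℂ A₁ A₁] [IsScalarTower ℂ A₁ A₁]
    [SMulCommClass ℂ A₂ A₂] [IsScalarTower ℂ A₂ A₂]
    (hE₁ : IsFunctionalSpace rE₁ ΘE₁)
    (hE₂ : IsFunctionalSpace rE₂ ΘE₂) (hU₁ : IsFunctionalExtension rE₁ ΘE₁ rF₁ ΘF₁ U₁ U₁s)
    (hU₂ : IsFunctionalExtension rE₂ ΘE₂ rF₂ ΘF₂ U₂ U₂s)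
    {p : (E₁ ⊗[ℂ] E₂ → A₁ ⊗[ℂ] A₂) × (F₁ ⊗[ℂ] F₂ → A₁ ⊗[ℂ] A₂)}
    (hp : p ∈ tensorStarGraph ΘE₁ ΘE₂ U₁s U₂s) (a : A₁ ⊗[ℂ] A₂) :
    ((fun x => a * p.1 x, fun y => a * p.2 y) :
      (E₁ ⊗[ℂ] E₂ → A₁ ⊗[ℂ] A₂) × (F₁ ⊗[ℂ] F₂ → A₁ ⊗[ℂ] A₂)) ∈
        tensorStarGraph ΘE₁ ΘE₂ U₁s U₂s := by
  induction hp using Submodule.span_induction with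
  | mem p hp =>
    obtain ⟨φ₁, hφ₁, φ₂, hφ₂, hh, hk⟩ := hp
    induction a with
    | zero =>
      simp only [zero_mul]
      exact zero_mem _
    | add a b ha hb =>
      simp only [add_mul]
      exact add_mem ha hb
    | tmul a₁ a₂ =>
      refine Submodule.subset_span
        ⟨_, hE₁.lsmul_mem a₁ hφ₁, _, hE₂.lsmul_mem a₂ hφ₂, hh.mul_left a₁ a₂, ?_⟩
      rw [hU₁.star_lsmul a₁ hφ₁, hU₂.star_lsmul a₂ hφ₂]
      exact hk.mul_left a₁ a₂
  | zero =>
    simp only [Prod.fst_zero, Prod.snd_zero, Pi.zero_apply, mul_zero]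
    exact zero_mem _
  | add _ _ _ _ h h' =>
    simp only [Prod.fst_add, Prod.snd_add, Pi.add_apply, mul_add]
    exact add_mem h h'
  | smul c _ _ h =>
    simp only [Prod.smul_fst, Prod.smul_snd, Pi.smul_apply, mul_smul_comm]
    exact Submodule.smul_mem _ c h

theorem snd_map_apply_eq_fst (hU₁ : IsFunctionalExtension rE₁ ΘE₁ rF₁ ΘF₁ U₁ U₁s)
    (hU₂ : IsFunctionalExtension rE₂ ΘE₂ rF₂ ΘF₂ U₂ U₂s)
    {p : (E₁ ⊗[ℂ] E₂ → A₁ ⊗[ℂ] A₂) × (F₁ ⊗[ℂ] F₂ → A₁ ⊗[ℂ] A₂)}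
    (hp : p ∈ tensorStarGraph ΘE₁ ΘE₂ U₁s U₂s) (x : E₁ ⊗[ℂ] E₂) :
    p.2 (TensorProduct.map hU₁.hom.toLinearMap hU₂.hom.toLinearMap x) = p.1 x := by
  induction hp using Submodule.span_induction with
  | mem p hp =>
    obtain ⟨φ₁, hφ₁, φ₂, hφ₂, hh, hk⟩ := hp
    induction x with
    | zero => rw [map_zero, hh.map_zero, hk.map_zero]
    | add x y hx hy => rw [map_add, hh.1, hk.1, hx, hy]
    | tmul ξ₁ ξ₂ =>
      rw [TensorProduct.map_tmul, hh.2, hk.2, ← hU₁.compat hφ₁, ← hU₂.compat hφ₂]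
      rfl
  | zero => rfl
  | add _ _ _ _ h h' => simp [h, h']
  | smul c _ _ h => simp [h]

theorem isModHom_map [SMulCommClass ℂ A₁ A₁] [IsScalarTower ℂ A₁ A₁]
    [SMulCommClass ℂ A₂ A₂] [IsScalarTower ℂ A₂ A₂]
    {rTE : RightMod (A₁ ⊗[ℂ] A₂) (E₁ ⊗[ℂ] E₂)}
    (hrTE : ∀ (ξ₁ : E₁) (ξ₂ : E₂) (a₁ : A₁) (a₂ : A₂),
      rTE.sm (ξ₁ ⊗ₜ[ℂ] ξ₂) (a₁ ⊗ₜ[ℂ] a₂) = rE₁.sm ξ₁ a₁ ⊗ₜ[ℂ] rE₂.sm ξ₂ a₂)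
    {rTF : RightMod (A₁ ⊗[ℂ] A₂) (F₁ ⊗[ℂ] F₂)}
    (hrTF : ∀ (η₁ : F₁) (η₂ : F₂) (a₁ : A₁) (a₂ : A₂),
      rTF.sm (η₁ ⊗ₜ[ℂ] η₂) (a₁ ⊗ₜ[ℂ] a₂) = rF₁.sm η₁ a₁ ⊗ₜ[ℂ] rF₂.sm η₂ a₂)
    (h₁ : IsModHom rE₁ rF₁ U₁) (h₂ : IsModHom rE₂ rF₂ U₂) :
    IsModHom rTE rTF (TensorProduct.map h₁.toLinearMap h₂.toLinearMap) := by
  refine ⟨map_add _, map_smul _, fun x a => ?_⟩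
  induction x with
  | zero => simp only [RightMod.zero_sm, map_zero]
  | add x y hx hy => simp only [RightMod.add_sm, map_add, hx, hy]
  | tmul ξ₁ ξ₂ =>
    induction a with
    | zero => simp only [RightMod.sm_zero, map_zero]
    | add a b ha hb => simp only [RightMod.sm_add, map_add, ha, hb]
    | tmul a₁ a₂ =>
      rw [hrTE, TensorProduct.map_tmul, TensorProduct.map_tmul, hrTF]
      exact congrArg₂ (· ⊗ₜ[ℂ] ·) (h₁.2.2 ξ₁ a₁) (h₂.2.2 ξ₂ a₂)

end Graph

end TensorFunctional

/-- The external tensor product of two functional extensions is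
a functional extension of right functional `(A₁ ⊗_ℂ A₂)`-modules; in particular
`φ₁ ⊗ φ₂ ↦ U₁^*(φ₁) ⊗ U₂^*(φ₂)` extends to a well-defined map on the functional
space of the external tensor product. -/
theorem extTensor_of_functionalExtensions
    {A₁ A₂ E₁ E₂ F₁ F₂ : Type*}
    [NonUnitalRing A₁] [Module ℂ A₁] [SMulCommClass ℂ A₁ A₁] [IsScalarTower ℂ A₁ A₁]
    [NonUnitalRing A₂] [Module ℂ A₂] [SMulCommClass ℂ A₂ A₂] [IsScalarTower ℂ A₂ A₂]
    [AddCommGroup E₁] [Module ℂ E₁] [AddCommGroup E₂] [Module ℂ E₂]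
    [AddCommGroup F₁] [Module ℂ F₁] [AddCommGroup F₂] [Module ℂ F₂]
    (rE₁ : RightMod A₁ E₁) (ΘE₁ : Set (E₁ → A₁)) (hE₁ : IsFunctionalSpace rE₁ ΘE₁)
    (rE₂ : RightMod A₂ E₂) (ΘE₂ : Set (E₂ → A₂)) (hE₂ : IsFunctionalSpace rE₂ ΘE₂)
    (rF₁ : RightMod A₁ F₁) (ΘF₁ : Set (F₁ → A₁)) (hF₁ : IsFunctionalSpace rF₁ ΘF₁)
    (rF₂ : RightMod A₂ F₂) (ΘF₂ : Set (F₂ → A₂)) (hF₂ : IsFunctionalSpace rF₂ ΘF₂)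
    (U₁ : E₁ → F₁) (U₁s : (E₁ → A₁) → F₁ → A₁)
    (U₂ : E₂ → F₂) (U₂s : (E₂ → A₂) → F₂ → A₂)
    (hU₁ : IsFunctionalExtension rE₁ ΘE₁ rF₁ ΘF₁ U₁ U₁s)
    (hU₂ : IsFunctionalExtension rE₂ ΘE₂ rF₂ ΘF₂ U₂ U₂s)
    -- the external tensor product module structures
    (rTE : RightMod (TensorProduct ℂ A₁ A₂) (TensorProduct ℂ E₁ E₂))
    (hrTE : ∀ (ξ₁ : E₁) (ξ₂ : E₂) (a₁ : A₁) (a₂ : A₂),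
      rTE.sm (ξ₁ ⊗ₜ[ℂ] ξ₂) (a₁ ⊗ₜ[ℂ] a₂) = rE₁.sm ξ₁ a₁ ⊗ₜ[ℂ] rE₂.sm ξ₂ a₂)
    (rTF : RightMod (TensorProduct ℂ A₁ A₂) (TensorProduct ℂ F₁ F₂))
    (hrTF : ∀ (η₁ : F₁) (η₂ : F₂) (a₁ : A₁) (a₂ : A₂),
      rTF.sm (η₁ ⊗ₜ[ℂ] η₂) (a₁ ⊗ₜ[ℂ] a₂) = rF₁.sm η₁ a₁ ⊗ₜ[ℂ] rF₂.sm η₂ a₂) :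
    ∃ (W : TensorProduct ℂ E₁ E₂ → TensorProduct ℂ F₁ F₂)
      (Wstar : (TensorProduct ℂ E₁ E₂ → TensorProduct ℂ A₁ A₂) →
        TensorProduct ℂ F₁ F₂ → TensorProduct ℂ A₁ A₂),
      (∀ x y, W (x + y) = W x + W y) ∧
      (∀ (ξ₁ : E₁) (ξ₂ : E₂), W (ξ₁ ⊗ₜ[ℂ] ξ₂) = U₁ ξ₁ ⊗ₜ[ℂ] U₂ ξ₂) ∧
      -- `U₁^* ⊗ U₂^*` is well defined on elementary tensor functionals
      (∀ φ₁ ∈ ΘE₁, ∀ φ₂ ∈ ΘE₂,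
        ∀ h : TensorProduct ℂ E₁ E₂ → TensorProduct ℂ A₁ A₂,
        ((∀ x y, h (x + y) = h x + h y) ∧
          ∀ (ξ₁ : E₁) (ξ₂ : E₂), h (ξ₁ ⊗ₜ[ℂ] ξ₂) = φ₁ ξ₁ ⊗ₜ[ℂ] φ₂ ξ₂) →
        (∀ x y, Wstar h (x + y) = Wstar h x + Wstar h y) ∧
          ∀ (η₁ : F₁) (η₂ : F₂),
            Wstar h (η₁ ⊗ₜ[ℂ] η₂) = U₁s φ₁ η₁ ⊗ₜ[ℂ] U₂s φ₂ η₂) ∧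
      IsFunctionalExtension rTE (extTensTheta ΘE₁ ΘE₂) rTF (extTensTheta ΘF₁ ΘF₂)
        W Wstar := by
  choose! S hS using fun h => exists_mem_tensorStarGraph (h := h) hF₁ hF₂ hU₁ hU₂
  have hS_eq {h k} (hk : (h, k) ∈ tensorStarGraph ΘE₁ ΘE₂ U₁s U₂s) : S h = k :=
    tensorStarGraph_right_unique hU₁ hU₂ (hS h (fst_mem_extTensTheta hk)) hk
  refine ⟨TensorProduct.map hU₁.hom.toLinearMap hU₂.hom.toLinearMap, S, map_add _,
    fun _ _ => rfl, fun φ₁ hφ₁ φ₂ hφ₂ h hh => ?_,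
    { hom := isModHom_map hrTE hrTF hU₁.hom hU₂.hom
      maps_mem := fun hh => snd_mem_extTensTheta hU₁ hU₂ (hS _ hh)
      star_add := fun hh hh' => hS_eq (add_mem (hS _ hh) (hS _ hh'))
      star_csmul := fun c _ hh => hS_eq (Submodule.smul_mem _ c (hS _ hh))
      star_lsmul := fun a _ hh => hS_eq (mul_mem_tensorStarGraph hE₁ hE₂ hU₁ hU₂ (hS _ hh) a)
      compat := fun hh => snd_map_apply_eq_fst hU₁ hU₂ (hS _ hh)
      inj := TensorProduct.map_injective_of_flat_flat _ _ hU₁.inj hU₂.inj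
      lift := fun k φ hφ => exists_lift_of_mem_tensorStarGraph hU₁ hU₂ fun i => hS _ (hφ i) }⟩
  obtain ⟨k, hk, hk'⟩ := exists_mem_tensorStarPairs hF₁ hF₂ hU₁ hU₂ hφ₁ hφ₂ hh
  rw [hS_eq (Submodule.subset_span hk)]
  exact hk'
end

section
/- Let A be an associative, not necessarily unital ℂ-algebra and (U, U^*) : (E, Θ_A(E)) → (F, Θ_A(F)) a functional extension of right functional A-modules. Then there is a well-defined injective algebra homomorphism f : K_A(E) → K_A(F) determined by f(θ_{ξ,φ}) = θ_{U(ξ), U^*(φ)} for all ξ ∈ E and φ ∈ Θ_A(E); that is: whenever Σ_{i=1}^m θ_{ξ_i,φ_i} = 0 in K_A(E) then Σ_{i=1}^m θ_{U(ξ_i),U^*(φ_i)} = 0 in K_A(F), the resulting additive map f is multiplicative, and f is injective. -/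
open scoped BigOperators TensorProduct

section Compacts

variable {A E F : Type*} [NonUnitalRing A] [Module ℂ A]
  [AddCommGroup E] [Module ℂ E] [AddCommGroup F] [Module ℂ F]
  {rE : RightMod A E} {ΘE : Set (E → A)} {rF : RightMod A F} {ΘF : Set (F → A)}
  {U : E → F} {Ustar : (E → A) → F → A}

theorem RightMod.sum_sm (r : RightMod A E) {m : ℕ} (x : Fin m → E) (a : A) :
    r.sm (∑ i, x i) a = ∑ i, r.sm (x i) a :=
  map_sum (AddMonoidHom.mk' (fun x => r.sm x a) fun x y => r.add_sm x y a) x Finset.univ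

theorem RightMod.sm_sum (r : RightMod A E) {m : ℕ} (x : E) (a : Fin m → A) :
    r.sm x (∑ i, a i) = ∑ i, r.sm x (a i) :=
  map_sum (AddMonoidHom.mk' (r.sm x) (r.sm_add x)) a Finset.univ

theorem IsModHom.map_sum (h : IsModHom rE rF U) {m : ℕ} (x : Fin m → E) :
    U (∑ i, x i) = ∑ i, U (x i) :=
  _root_.map_sum (AddMonoidHom.mk' U h.1) x Finset.univ

theorem IsFunctional.map_sum {φ : E → A} (h : IsFunctional rE φ) {m : ℕ} (x : Fin m → E) :
    φ (∑ i, x i) = ∑ i, φ (x i) :=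
  _root_.map_sum (AddMonoidHom.mk' φ h.1) x Finset.univ

/-- `G` is obtained from a presentation of `S` as a finite sum of operators `θ_{ξ,φ}`
by replacing each of them with `θ_{U(ξ),U^*(φ)}`. -/
def InducedOp (rE : RightMod A E) (ΘE : Set (E → A)) (rF : RightMod A F)
    (U : E → F) (Ustar : (E → A) → F → A) (S : E → E) (G : F → F) : Prop :=
  ∃ (m : ℕ) (η : Fin m → E) (φ : Fin m → E → A), (∀ i, φ i ∈ ΘE) ∧
    S = ∑ i, elemOp rE (η i) (φ i) ∧ G = ∑ i, elemOp rF (U (η i)) (Ustar (φ i))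

theorem exists_inducedOp {S : E → E} (hS : S ∈ KSet rE ΘE) :
    ∃ G, InducedOp rE ΘE rF U Ustar S G := by
  obtain ⟨m, η, φ, hφ, rfl⟩ := hS
  exact ⟨_, m, η, φ, hφ, rfl, rfl⟩

theorem IsModHom.map_sum_elemOp (h : IsModHom rE rF U) {m : ℕ} (η : Fin m → E)
    (φ : Fin m → E → A) (ψ : Fin m → F → A) {x : E} {y : F} (hxy : ∀ i, ψ i y = φ i x) :
    (∑ i, elemOp rF (U (η i)) (ψ i)) y = U ((∑ i, elemOp rE (η i) (φ i)) x) := by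
  simp only [Finset.sum_apply, elemOp, h.map_sum, h.2.2, hxy]

theorem InducedOp.apply_map {S : E → E} {G : F → F}
    (hS : InducedOp rE ΘE rF U Ustar S G)
    (hU : IsFunctionalHom rE ΘE rF ΘF U Ustar) (x : E) : G (U x) = U (S x) := by
  obtain ⟨m, η, φ, hφ, rfl, rfl⟩ := hS
  exact hU.hom.map_sum_elemOp η φ _ fun i => hU.compat (hφ i) x

theorem InducedOp.exists_lift {S T : E → E} {G H : F → F}
    (hS : InducedOp rE ΘE rF U Ustar S G) (hT : InducedOp rE ΘE rF U Ustar T H)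
    (hU : IsFunctionalExtension rE ΘE rF ΘF U Ustar) (y : F) :
    ∃ x, G y = U (S x) ∧ H y = U (T x) := by
  obtain ⟨m, η, φ, hφ, rfl, rfl⟩ := hS
  obtain ⟨n, ζ, ψ, hψ, rfl, rfl⟩ := hT
  obtain ⟨x, hx⟩ := hU.lift (m + n) (Fin.append φ ψ)
    (fun i => Fin.addCases (by simpa using hφ) (by simpa using hψ) i) y
  refine ⟨x, hU.hom.map_sum_elemOp η φ _ fun i => ?_, hU.hom.map_sum_elemOp ζ ψ _ fun i => ?_⟩
  · simpa using hx (Fin.castAdd n i)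
  · simpa using hx (Fin.natAdd m i)

theorem InducedOp.unique {S : E → E} {G H : F → F}
    (hG : InducedOp rE ΘE rF U Ustar S G) (hH : InducedOp rE ΘE rF U Ustar S H)
    (hU : IsFunctionalExtension rE ΘE rF ΘF U Ustar) : G = H := by
  funext y
  obtain ⟨x, h₁, h₂⟩ := hG.exists_lift hH hU y
  rw [h₁, h₂]

theorem InducedOp.add {S T : E → E} {G H : F → F}
    (hS : InducedOp rE ΘE rF U Ustar S G) (hT : InducedOp rE ΘE rF U Ustar T H) :
    InducedOp rE ΘE rF U Ustar (S + T) (G + H) := by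
  obtain ⟨m, η, φ, hφ, rfl, rfl⟩ := hS
  obtain ⟨n, ζ, ψ, hψ, rfl, rfl⟩ := hT
  refine ⟨m + n, Fin.append η ζ, Fin.append φ ψ,
    fun i => Fin.addCases (by simpa using hφ) (by simpa using hψ) i, ?_, ?_⟩ <;>
  simp [Fin.sum_univ_add]

theorem sum_elemOp_map_sm (hE : IsFunctionalSpace rE ΘE) {m : ℕ} (η : Fin m → E)
    {φ : Fin m → E → A} (hφ : ∀ i, φ i ∈ ΘE) (x : E) (a : A) :
    (∑ i, elemOp rE (η i) (φ i)) (rE.sm x a) = rE.sm ((∑ i, elemOp rE (η i) (φ i)) x) a := by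
  simp only [Finset.sum_apply, elemOp, rE.sum_sm, (hE.functional _ (hφ _)).2.2, rE.sm_mul]

theorem sum_elemOp_map_sum (hE : IsFunctionalSpace rE ΘE) {m n : ℕ} (η : Fin m → E)
    {φ : Fin m → E → A} (hφ : ∀ i, φ i ∈ ΘE) (x : Fin n → E) :
    (∑ i, elemOp rE (η i) (φ i)) (∑ j, x j) = ∑ j, (∑ i, elemOp rE (η i) (φ i)) (x j) := by
  simp only [Finset.sum_apply, elemOp, (hE.functional _ (hφ _)).map_sum, rE.sm_sum]
  exact Finset.sum_comm

theorem comp_mem_KSet (hE : IsFunctionalSpace rE ΘE) {S T : E → E}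
    (hS : S ∈ KSet rE ΘE) (hT : T ∈ KSet rE ΘE) : S ∘ T ∈ KSet rE ΘE := by
  obtain ⟨m, η, φ, hφ, rfl⟩ := hS
  obtain ⟨n, ζ, ψ, hψ, rfl⟩ := hT
  refine ⟨n, fun j => (∑ i, elemOp rE (η i) (φ i)) (ζ j), ψ, hψ, ?_⟩
  funext x
  rw [Function.comp_apply, Finset.sum_apply x Finset.univ fun j => elemOp rE (ζ j) (ψ j),
    sum_elemOp_map_sum hE η hφ, Finset.sum_apply]
  exact Finset.sum_congr rfl fun j _ => sum_elemOp_map_sm hE η hφ _ _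

end Compacts

/-- A functional extension `(U, U^*) : E → F` induces a
well-defined injective algebra homomorphism `f : K_A(E) → K_A(F)` determined by
`f(θ_{ξ,φ}) = θ_{U(ξ),U^*(φ)}`. -/
theorem functionalExtension_induces_injective_hom_of_compacts
    {A E F : Type*} [NonUnitalRing A] [Module ℂ A]
    [SMulCommClass ℂ A A] [IsScalarTower ℂ A A]
    [AddCommGroup E] [Module ℂ E] [AddCommGroup F] [Module ℂ F]
    (rE : RightMod A E) (ΘE : Set (E → A)) (rF : RightMod A F) (ΘF : Set (F → A))
    (hE : IsFunctionalSpace rE ΘE) (hF : IsFunctionalSpace rF ΘF)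
    (U : E → F) (Ustar : (E → A) → F → A)
    (hU : IsFunctionalExtension rE ΘE rF ΘF U Ustar) :
    -- well-definedness
    (∀ (m : ℕ) (η : Fin m → E) (φ : Fin m → E → A), (∀ i, φ i ∈ ΘE) →
      ∑ i, elemOp rE (η i) (φ i) = 0 →
      ∑ i, elemOp rF (U (η i)) (Ustar (φ i)) = 0) ∧
    -- the resulting map is additive, multiplicative and injective on `K_A(E)`
    ∃ f : (E → E) → F → F,
      (∀ (m : ℕ) (η : Fin m → E) (φ : Fin m → E → A), (∀ i, φ i ∈ ΘE) →
        f (∑ i, elemOp rE (η i) (φ i)) = ∑ i, elemOp rF (U (η i)) (Ustar (φ i))) ∧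
      (∀ S T : E → E, S ∈ KSet rE ΘE → T ∈ KSet rE ΘE → f (S + T) = f S + f T) ∧
      (∀ S T : E → E, S ∈ KSet rE ΘE → T ∈ KSet rE ΘE → f (S ∘ T) = f S ∘ f T) ∧
      Set.InjOn f (KSet rE ΘE) := by
  classical
  let f : (E → E) → F → F := fun S =>
    if h : ∃ G, InducedOp rE ΘE rF U Ustar S G then h.choose else 0
  have hf : ∀ {S G}, InducedOp rE ΘE rF U Ustar S G → f S = G := fun {S G} h => by
    have h' : ∃ G, InducedOp rE ΘE rF U Ustar S G := ⟨G, h⟩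
    simpa only [f, dif_pos h'] using h'.choose_spec.unique h hU
  refine ⟨fun m η φ hφ h => ?_, f, fun m η φ hφ => hf ⟨m, η, φ, hφ, rfl, rfl⟩,
    fun S T hS hT => ?_, fun S T hS hT => ?_, fun S hS T hT h => ?_⟩
  · exact InducedOp.unique ⟨m, η, φ, hφ, h.symm, rfl⟩
      ⟨0, Fin.elim0, Fin.elim0, fun i => i.elim0, by simp, by simp⟩ hU
  · obtain ⟨G, hG⟩ := exists_inducedOp (rF := rF) (U := U) (Ustar := Ustar) hS
    obtain ⟨H, hH⟩ := exists_inducedOp (rF := rF) (U := U) (Ustar := Ustar) hT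
    rw [hf hG, hf hH, hf (hG.add hH)]
  · obtain ⟨G, hG⟩ := exists_inducedOp (rF := rF) (U := U) (Ustar := Ustar) hS
    obtain ⟨H, hH⟩ := exists_inducedOp (rF := rF) (U := U) (Ustar := Ustar) hT
    obtain ⟨K, hK⟩ := exists_inducedOp (rF := rF) (U := U) (Ustar := Ustar)
      (comp_mem_KSet hE hS hT)
    rw [hf hG, hf hH, hf hK]
    funext y
    obtain ⟨x, h₁, h₂⟩ := hK.exists_lift hH hU y
    rw [h₁, Function.comp_apply, Function.comp_apply, h₂, hG.apply_map hU.toIsFunctionalHom]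
  · obtain ⟨G, hG⟩ := exists_inducedOp (rF := rF) (U := U) (Ustar := Ustar) hS
    obtain ⟨H, hH⟩ := exists_inducedOp (rF := rF) (U := U) (Ustar := Ustar) hT
    rw [hf hG, hf hH] at h
    funext x
    apply hU.inj
    rw [← hG.apply_map hU.toIsFunctionalHom, ← hH.apply_map hU.toIsFunctionalHom, h]
end

section
/- Let A be an associative, not necessarily unital ℂ-algebra, let (E, Θ_A(E)) and (F, Θ_A(F)) be right functional A-modules, let U : E → F be an injective right A-module homomorphism, and let U^* : Θ_A(E) → Θ_A(F) be any function satisfying U^*(φ)(U(ξ)) = φ(ξ) for all φ ∈ Θ_A(E), ξ ∈ E, and such that for any finitely many φ_1,…,φ_k ∈ Θ_A(E) and any η ∈ F there exists ξ ∈ E with U^*(φ_i)(η) = φ_i(ξ) for all i. Then U^* is automatically additive and left A-homogeneous: U^*(φ + ψ) = U^*(φ) + U^*(ψ) and U^*(a·φ) = a·U^*(φ) for all φ, ψ ∈ Θ_A(E) and a ∈ A. -/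
open scoped BigOperators TensorProduct

/-- For an injective right `A`-module homomorphism `U` and any
function `U^*` on the functional spaces satisfying the compatibility
`U^*(φ)(U(ξ)) = φ(ξ)` and the functional-extension lifting property, the map
`U^*` is automatically additive and left `A`-homogeneous. -/
theorem functionalExtension_star_additive_and_homogeneous
    {A E F : Type*} [NonUnitalRing A] [Module ℂ A]
    [SMulCommClass ℂ A A] [IsScalarTower ℂ A A]
    [AddCommGroup E] [Module ℂ E] [AddCommGroup F] [Module ℂ F]
    (rE : RightMod A E) (ΘE : Set (E → A)) (rF : RightMod A F) (ΘF : Set (F → A))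
    (hE : IsFunctionalSpace rE ΘE) (hF : IsFunctionalSpace rF ΘF)
    (U : E → F) (Ustar : (E → A) → F → A)
    (hUhom : IsModHom rE rF U) (hUinj : Function.Injective U)
    (hmaps : ∀ φ ∈ ΘE, Ustar φ ∈ ΘF)
    (hcompat : ∀ φ ∈ ΘE, ∀ ξ : E, Ustar φ (U ξ) = φ ξ)
    (hlift : ∀ (k : ℕ) (φ : Fin k → E → A), (∀ i, φ i ∈ ΘE) → ∀ η : F,
      ∃ ξ : E, ∀ i, Ustar (φ i) η = φ i ξ) :
    (∀ φ ∈ ΘE, ∀ ψ ∈ ΘE, Ustar (φ + ψ) = Ustar φ + Ustar ψ) ∧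
    (∀ (a : A), ∀ φ ∈ ΘE, Ustar (fun ξ => a * φ ξ) = fun η => a * Ustar φ η) := by
  refine ⟨fun φ hφ ψ hψ => ?_, fun a φ hφ => ?_⟩
  · funext η
    obtain ⟨ξ, hξ⟩ := hlift 3 ![φ, ψ, φ + ψ]
      (by simp [Fin.forall_fin_succ, hφ, hψ, hE.add_mem hφ hψ]) η
    have h₀ : Ustar φ η = φ ξ := hξ 0
    have h₁ : Ustar ψ η = ψ ξ := hξ 1
    have h₂ : Ustar (φ + ψ) η = (φ + ψ) ξ := hξ 2
    rw [h₂, Pi.add_apply, Pi.add_apply, h₀, h₁]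
  · funext η
    obtain ⟨ξ, hξ⟩ := hlift 2 ![φ, fun ξ => a * φ ξ]
      (by simp [Fin.forall_fin_succ, hφ, hE.lsmul_mem a hφ]) η
    have h₀ : Ustar φ η = φ ξ := hξ 0
    have h₁ : Ustar (fun ξ => a * φ ξ) η = a * φ ξ := hξ 1
    rw [h₁, h₀]
end
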